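/- The bound C_r(ρ) ≥ S(d) − S(d∨p) is tight in the following sense: for any two probability vectors d, p ∈ ℝⁿ there exist an n×n density matrix ρ and a von Neumann measurement {|ψ_i⟩}_{i=1}^n such that (i) the vector of diagonal entries of ρ in the reference basis is d, (ii) ⟨ψ_i|ρ|ψ_i⟩ = p_i for all i, and (iii) the eigenvalue vector of ρ equals d∨p; consequently C_r(ρ) = S(d) − S(d∨p). -/

import Mathlib

open Matrix Finset ComplexOrder

/-- The vector `x` sorted in descending order. -/
noncomputable def sortDesc {n : ℕ} (x : Fin n → ℝ) : Fin n → ℝ :=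
  fun i => x (Tuple.sort x i.rev)

/-- The sum of the `k` largest entries of `x`. -/
noncomputable def topSum {n : ℕ} (x : Fin n → ℝ) (k : ℕ) : ℝ :=
  ∑ i ∈ Finset.univ.filter (fun i : Fin n => (i : ℕ) < k), sortDesc x i

/-- `Maj b a` means `b ≺ a`, i.e. `a` majorizes `b`. -/
def Maj {n : ℕ} (b a : Fin n → ℝ) : Prop := ∀ k : ℕ, topSum b k ≤ topSum a k

/-- `p` is a probability vector. -/
def IsProbVec {n : ℕ} (p : Fin n → ℝ) : Prop := (∀ i, 0 ≤ p i) ∧ ∑ i, p i = 1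

/-- Shannon entropy (base 2). -/
noncomputable def shannon {ι : Type*} [Fintype ι] (p : ι → ℝ) : ℝ :=
  -∑ i, p i * Real.logb 2 (p i)

/-- A von Neumann measurement: an orthonormal basis of `ℂⁿ`. -/
def IsONB {n : ℕ} (ψ : Fin n → (Fin n → ℂ)) : Prop :=
  ∀ i j, star (ψ i) ⬝ᵥ ψ j = if i = j then 1 else 0

/-- Outcome distribution of the measurement `ψ` on the state `ρ`. -/
noncomputable def outcome {n : ℕ} (ρ : Matrix (Fin n) (Fin n) ℂ)
    (ψ : Fin n → (Fin n → ℂ)) : Fin n → ℝ :=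
  fun i => (star (ψ i) ⬝ᵥ (ρ *ᵥ ψ i)).re

/-- Vector of diagonal entries of `ρ` (real parts). -/
noncomputable def diagVec {n : ℕ} (ρ : Matrix (Fin n) (Fin n) ℂ) : Fin n → ℝ :=
  fun i => (ρ i i).re

/-- `c` is the majorization join of `a` and `b`. -/
def IsMajJoin {n : ℕ} (a b c : Fin n → ℝ) : Prop :=
  IsProbVec c ∧ Maj a c ∧ Maj b c ∧
    ∀ c', IsProbVec c' → Maj a c' → Maj b c' → Maj c c'

/-- `c` is the majorization meet of the set `X`. -/
def IsMajMeet {n : ℕ} (X : Set (Fin n → ℝ)) (c : Fin n → ℝ) : Prop :=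
  IsProbVec c ∧ (∀ p ∈ X, Maj c p) ∧
    ∀ c', IsProbVec c' → (∀ p ∈ X, Maj c' p) → Maj c' c

lemma sortDesc_antitone {n : ℕ} (x : Fin n → ℝ) : Antitone (sortDesc x) := fun _ _ h =>
  Tuple.monotone_sort x (Fin.rev_le_rev.2 h)

lemma sortDesc_comp_perm {n : ℕ} (x : Fin n → ℝ) (σ : Equiv.Perm (Fin n)) :
    sortDesc (x ∘ σ) = sortDesc x :=
  funext fun i => congrFun (Tuple.comp_perm_comp_sort_eq_comp_sort (f := x) (σ := σ)) i.rev

lemma exists_perm_sortDesc_eq {n : ℕ} (x : Fin n → ℝ) :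
    ∃ σ : Equiv.Perm (Fin n), sortDesc x = x ∘ σ :=
  ⟨Fin.revPerm.trans (Tuple.sort x), rfl⟩

lemma shannon_comp_perm {ι : Type*} [Fintype ι] (x : ι → ℝ) (σ : Equiv.Perm ι) :
    shannon (x ∘ σ) = shannon x := by
  simp only [shannon, Function.comp_apply]
  rw [Equiv.sum_comp σ fun i => x i * Real.logb 2 (x i)]

lemma IsONB.comp_perm {n : ℕ} {ψ : Fin n → Fin n → ℂ} (h : IsONB ψ) (σ : Equiv.Perm (Fin n)) :
    IsONB (ψ ∘ σ) := fun i j => by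
  simpa using h (σ i) (σ j)

/-- The coefficients of a rotation in a plane that moves the diagonal entries of a Hermitian
matrix by a fraction `t` of their difference; `w` is the off-diagonal entry. -/
lemma exists_rotation_coeff (w : ℂ) {t : ℝ} (h0 : 0 ≤ t) (h1 : t ≤ 1) :
    ∃ (a : ℝ) (z : ℂ), a ^ 2 = 1 - t ∧ star z * z = t ∧ z * w + star z * star w = 0 := by
  have ht : ((√t : ℝ) : ℂ) * (√t : ℝ) = t := by
    rw [← Complex.ofReal_mul, Real.mul_self_sqrt h0]
  by_cases hw : w = 0
  · exact ⟨√(1 - t), (√t : ℝ), Real.sq_sqrt (by linarith), by simpa using ht, by simp [hw]⟩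
  · have hn : ((‖w‖ : ℝ) : ℂ) ≠ 0 := by simpa using hw
    have hc : star w * w = (‖w‖ : ℂ) ^ 2 := Complex.conj_mul' w
    refine ⟨√(1 - t), (√t : ℝ) * (Complex.I * star w / ‖w‖), Real.sq_sqrt (by linarith), ?_, ?_⟩
    · simp only [star_mul', star_div₀, Complex.star_def, Complex.conj_ofReal,
        Complex.conj_I, Complex.conj_conj] at hc ⊢
      field_simp
      linear_combination (-Complex.I ^ 2 * ((√t : ℝ) : ℂ) ^ 2) * hc
        - (‖w‖ : ℂ) ^ 2 * ((√t : ℝ) : ℂ) ^ 2 * Complex.I_sq + (‖w‖ : ℂ) ^ 2 * ht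
    · simp only [star_mul', star_div₀, Complex.star_def, Complex.conj_ofReal,
        Complex.conj_I, Complex.conj_conj]
      ring

/-- The set of diagonals of a Hermitian matrix in orthonormal bases is closed under transfers
from a larger entry to a smaller one. -/
lemma IsONB.exists_transfer {n : ℕ} {A : Matrix (Fin n) (Fin n) ℂ} (hA : A.IsHermitian)
    {x : Fin n → ℝ} {ψ : Fin n → Fin n → ℂ} (hψ : IsONB ψ)
    (hx : ∀ i, star (ψ i) ⬝ᵥ (A *ᵥ ψ i) = (x i : ℂ)) {j k : Fin n} (hjk : j ≠ k) {δ : ℝ}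
    (h0 : 0 ≤ δ) (h1 : δ ≤ x j - x k) :
    ∃ φ : Fin n → Fin n → ℂ, IsONB φ ∧ ∀ i, star (φ i) ⬝ᵥ (A *ᵥ φ i) =
      (Function.update (Function.update x j (x j - δ)) k (x k + δ) i : ℂ) := by
  obtain ⟨t, ht0, ht1, ht⟩ : ∃ t : ℝ, 0 ≤ t ∧ t ≤ 1 ∧ δ = t * (x j - x k) := by
    rcases (h0.trans h1).eq_or_lt with h | h
    · exact ⟨0, le_rfl, zero_le_one, by linarith⟩
    · exact ⟨δ / (x j - x k), by positivity, (div_le_one h).2 h1, by field_simp⟩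
  have hw : star (ψ k) ⬝ᵥ (A *ᵥ ψ j) = star (star (ψ j) ⬝ᵥ (A *ᵥ ψ k)) := by
    rw [← star_dotProduct_star, star_star, star_mulVec, hA.eq, ← dotProduct_mulVec,
      dotProduct_comm, dotProduct_comm (A *ᵥ ψ j)]
  obtain ⟨a, z, ha, hz, haz⟩ := exists_rotation_coeff (star (ψ j) ⬝ᵥ (A *ᵥ ψ k)) ht0 ht1
  have ha' : (a : ℂ) ^ 2 = 1 - t := by exact_mod_cast congrArg Complex.ofReal ha
  have hsa : star (a : ℂ) = a := Complex.conj_ofReal a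
  have h : ∀ i l, star (ψ i) ⬝ᵥ ψ l = if i = l then 1 else 0 := hψ
  obtain ⟨u, hu⟩ : ∃ u, u = (a : ℂ) • ψ j + z • ψ k := ⟨_, rfl⟩
  obtain ⟨v, hv⟩ : ∃ v, v = (-star z) • ψ j + (a : ℂ) • ψ k := ⟨_, rfl⟩
  have hsu : star u = (a : ℂ) • star (ψ j) + star z • star (ψ k) := by
    rw [hu, star_add, star_smul, star_smul, hsa]
  have hsv : star v = (-z) • star (ψ j) + (a : ℂ) • star (ψ k) := by
    rw [hv, star_add, star_smul, star_smul, hsa, star_neg, star_star]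
  simp only [Complex.star_def] at hz haz
  refine ⟨Function.update (Function.update ψ j u) k v, fun i l => ?_, fun i => ?_⟩
  · have huu : star u ⬝ᵥ u = 1 := by
      simp only [hsu]
      simp [hu, h, hjk, hjk.symm]
      linear_combination ha' + hz
    have hvv : star v ⬝ᵥ v = 1 := by
      simp only [hsv]
      simp [hv, h, hjk, hjk.symm]
      linear_combination ha' + hz
    have huv : star u ⬝ᵥ v = 0 := by
      simp only [hsu]
      simp [hv, h, hjk, hjk.symm]
      ring
    have hvu : star v ⬝ᵥ u = 0 := by
      simp only [hsv]
      simp [hu, h, hjk, hjk.symm]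
      ring
    have hi : ∀ i, i ≠ j → i ≠ k → star (ψ i) ⬝ᵥ u = 0 ∧ star (ψ i) ⬝ᵥ v = 0 ∧
        star u ⬝ᵥ ψ i = 0 ∧ star v ⬝ᵥ ψ i = 0 := fun i hij hik => by
      simp only [hsu, hsv]
      simp [hu, hv, h, hij, hik, hij.symm, hik.symm]
    simp only [Function.update_apply]
    clear hu hv hsu hsv hw haz hx
    split_ifs <;> grind
  · have hBu : star u ⬝ᵥ (A *ᵥ u) = (x j - δ : ℝ) := by
      simp only [hsu]
      simp [hu, mulVec_add, mulVec_smul, hx, hw, ht]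
      linear_combination (x j : ℂ) * ha' + (x k : ℂ) * hz + (a : ℂ) * haz
    have hBv : star v ⬝ᵥ (A *ᵥ v) = (x k + δ : ℝ) := by
      simp only [hsv]
      simp [hv, mulVec_add, mulVec_smul, mulVec_neg, hx, hw, ht]
      linear_combination (x k : ℂ) * ha' + (x j : ℂ) * hz - (a : ℂ) * haz
    simp only [Function.update_apply]
    split_ifs
    exacts [hBv, hBu, hx i]

/-- If `x` is the diagonal of a Hermitian matrix in some orthonormal basis and the prefix sums of
`x` dominate those of the decreasing vector `b`, then `b` is such a diagonal too. -/
lemma exists_isONB_of_prefix_le {n : ℕ} {A : Matrix (Fin n) (Fin n) ℂ} (hA : A.IsHermitian)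
    {b : Fin n → ℝ} (hb : Antitone b) (m : ℕ) (x : Fin n → ℝ)
    (hm : #{i | x i ≠ b i} ≤ m)
    (hpre : ∀ l : ℕ, ∑ i with i.val < l, b i ≤ ∑ i with i.val < l, x i)
    (hsum : ∑ i, x i = ∑ i, b i)
    (hx : ∃ ψ, IsONB ψ ∧ ∀ i, star (ψ i) ⬝ᵥ (A *ᵥ ψ i) = (x i : ℂ)) :
    ∃ ψ, IsONB ψ ∧ ∀ i, star (ψ i) ⬝ᵥ (A *ᵥ ψ i) = (b i : ℂ) := by
  induction m generalizing x with
  | zero =>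
    have : x = b := by
      funext i
      by_contra h
      simpa [h] using (card_eq_zero.1 (Nat.le_zero.1 hm)).subset (mem_filter.2 ⟨mem_univ i, h⟩)
    exact this ▸ hx
  | succ m ih =>
    by_cases hxb : x = b
    · exact hxb ▸ hx
    obtain ⟨k, hk, hkmin⟩ : ∃ k, x k < b k ∧ ∀ i < k, b i ≤ x i := by
      have hne : ∃ i, x i < b i := by
        by_contra! h
        exact hxb (funext fun i => ((sum_eq_sum_iff_of_le fun i _ => h i).1 hsum.symm i
          (mem_univ i)).symm)
      obtain ⟨k, hk⟩ := (Set.toFinite {i | x i < b i}).exists_minimal hne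
      exact ⟨k, hk.prop, fun i hi => not_lt.1 fun h => hk.not_prop_of_lt hi h⟩
    obtain ⟨j, hjk, hj⟩ : ∃ j < k, b j < x j := by
      by_contra! h
      refine (hpre (k + 1)).not_gt (sum_lt_sum (fun i hi => ?_) ⟨k, by simp, hk⟩)
      rcases (Fin.le_def.2 (Nat.lt_succ_iff.1 (mem_filter.1 hi).2)).lt_or_eq with h' | rfl
      exacts [h i h', hk.le]
    obtain ⟨ψ, hψ, hψx⟩ := hx
    set δ := min (x j - b j) (b k - x k) with hδ
    have hδj : δ ≤ x j - b j := min_le_left _ _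
    have hδk : δ ≤ b k - x k := min_le_right _ _
    have hδ0 : 0 ≤ δ := le_min (by linarith) (by linarith)
    have hbjk := hb hjk.le
    set y := Function.update (Function.update x j (x j - δ)) k (x k + δ) with hy
    have hyi : ∀ i, y i = x i + ((if i = k then δ else 0) - if i = j then δ else 0) := by
      intro i
      by_cases hik : i = k <;> by_cases hij : i = j <;> grind
    refine ih y ?_ (fun l => ?_) ?_ (hψ.exists_transfer hA hψx hjk.ne hδ0 (by linarith))
    · refine Nat.lt_succ_iff.1 ((card_lt_card ?_).trans_le hm)
      refine (ssubset_iff_of_subset fun i hi => ?_).2 ?_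
      · grind
      · rcases min_choice (x j - b j) (b k - x k) with h | h
        · exact ⟨j, by grind, by grind⟩
        · exact ⟨k, by grind, by grind⟩
    · have hyl : ∑ i with i.val < l, y i = ∑ i with i.val < l, x i
          + ((if k.val < l then δ else 0) - if j.val < l then δ else 0) := by
        simp [hyi, sum_add_distrib, sum_sub_distrib, sum_filter]
      have hjk' : j.val < k.val := hjk
      rw [hyl]
      by_cases hkl : k.val < l
      · simpa [hkl, hjk'.trans hkl] using hpre l
      by_cases hjl : j.val < l
      · have hs : x j - b j ≤ ∑ i with i.val < l, (x i - b i) :=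
          single_le_sum (f := fun i => x i - b i) (fun i hi => sub_nonneg.2 (hkmin i (by
            have := (mem_filter.1 hi).2
            exact Fin.lt_def.2 (by omega)))) (by simpa using hjl)
        rw [sum_sub_distrib] at hs
        simp only [hkl, hjl, if_true, if_false]
        linarith
      · simpa [hkl, hjl] using hpre l
    · simp [hyi, sum_add_distrib, sum_sub_distrib, hsum]

/-- Horn's theorem for diagonal matrices with decreasing entries. -/
lemma exists_isONB_of_maj {n : ℕ} {b c : Fin n → ℝ} (h : Maj b c)
    (hsum : ∑ i, c i = ∑ i, b i) :
    ∃ ψ, IsONB ψ ∧ ∀ i, star (ψ i) ⬝ᵥ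
      (diagonal (fun i => (sortDesc c i : ℂ)) *ᵥ ψ i) = (b i : ℂ) := by
  have hA : (diagonal fun i => (sortDesc c i : ℂ)).IsHermitian :=
    isHermitian_diagonal_of_self_adjoint _ (funext fun i => Complex.conj_ofReal _)
  obtain ⟨σ, hσ⟩ := exists_perm_sortDesc_eq b
  obtain ⟨τ, hτ⟩ := exists_perm_sortDesc_eq c
  obtain ⟨ψ, hψ, hψb⟩ := exists_isONB_of_prefix_le hA (sortDesc_antitone b) _ (sortDesc c) le_rfl
    h (by simpa [hσ, hτ, Equiv.sum_comp] using hsum)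
    ⟨fun i => Pi.single i 1, fun i j => by simp [Pi.single_apply, eq_comm], fun i => by simp⟩
  exact ⟨ψ ∘ σ.symm, hψ.comp_perm _, fun i => by simp [hψb, hσ]⟩

lemma exists_perm_of_map_univ_eq {n : ℕ} {x y : Fin n → ℝ}
    (h : univ.val.map x = univ.val.map y) : ∃ σ : Equiv.Perm (Fin n), x = y ∘ σ := by
  rw [Fin.univ_val_map, Fin.univ_val_map, Multiset.coe_eq_coe] at h
  have hs : x ∘ Tuple.sort x = y ∘ Tuple.sort y :=
    List.ofFn_injective <|
      (((Tuple.sort x).ofFn_comp_perm x).trans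
        (h.trans ((Tuple.sort y).ofFn_comp_perm y).symm)).eq_of_pairwise'
        (Tuple.monotone_sort x).sortedLE_ofFn.pairwise
        (Tuple.monotone_sort y).sortedLE_ofFn.pairwise
  refine ⟨(Tuple.sort x).symm.trans (Tuple.sort y), funext fun i => ?_⟩
  simpa using congrFun hs ((Tuple.sort x).symm i)

lemma exists_perm_eigenvalues_eq {n : ℕ} {A : Matrix (Fin n) (Fin n) ℂ} (hA : A.IsHermitian)
    {x : Fin n → ℝ} (h : A.charpoly = (diagonal fun i => (x i : ℂ)).charpoly) :
    ∃ σ : Equiv.Perm (Fin n), hA.eigenvalues = x ∘ σ := by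
  refine exists_perm_of_map_univ_eq (Multiset.map_injective Complex.ofReal_injective ?_)
  have h1 := hA.roots_charpoly_eq_eigenvalues
  rw [h, charpoly_diagonal, Polynomial.roots_prod _ _
    (prod_ne_zero_iff.2 fun i _ => Polynomial.X_sub_C_ne_zero _)] at h1
  simpa [Function.comp_def] using h1.symm

/-- Tightness of the bound `C_r(ρ) ≥ S(d) − S(d∨p)`: for any probability
vectors `d, p` there are a density matrix `ρ` and a von Neumann measurement with
diagonal `d`, outcomes `p`, and eigenvalue vector equal (as a sorted vector) to
`d ∨ p`; consequently `C_r(ρ) = S(d) − S(d∨p)`. -/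
theorem stmt6 {n : ℕ} (d p c : Fin n → ℝ) (hd : IsProbVec d) (hp : IsProbVec p)
    (hc : IsMajJoin d p c) :
    ∃ (ρ : Matrix (Fin n) (Fin n) ℂ) (hρ : ρ.PosSemidef), ρ.trace = 1 ∧
      (∀ i, ρ i i = (d i : ℂ)) ∧
      (∃ ψ : Fin n → (Fin n → ℂ), IsONB ψ ∧
        ∀ i, star (ψ i) ⬝ᵥ (ρ *ᵥ ψ i) = (p i : ℂ)) ∧
      sortDesc hρ.isHermitian.eigenvalues = sortDesc c ∧
      shannon (diagVec ρ) - shannon hρ.isHermitian.eigenvalues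
        = shannon d - shannon c := by
  obtain ⟨hcp, hdc, hpc, -⟩ := hc
  obtain ⟨ψ, hψ, hψd⟩ := exists_isONB_of_maj hdc (hcp.2.trans hd.2.symm)
  obtain ⟨φ, hφ, hφp⟩ := exists_isONB_of_maj hpc (hcp.2.trans hp.2.symm)
  obtain ⟨τ, hτ⟩ := exists_perm_sortDesc_eq c
  set A := diagonal fun i => (sortDesc c i : ℂ) with hA
  have hA0 : A.PosSemidef := PosSemidef.diagonal fun i => by
    simpa [hτ] using hcp.1 (τ i)
  set U : Matrix (Fin n) (Fin n) ℂ := (of ψ)ᵀ with hU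
  have hUU : Uᴴ * U = 1 := by
    ext i j
    simpa [mul_apply, dotProduct, hU, one_apply] using hψ i j
  have hUU' : U * Uᴴ = 1 := mul_eq_one_comm.1 hUU
  have hdiag : ∀ i, (Uᴴ * A * U) i i = (d i : ℂ) := fun i => by
    rw [← hψd i, Matrix.mul_assoc, mul_apply]
    rfl
  have hρ : (Uᴴ * A * U).PosSemidef := hA0.conjTranspose_mul_mul_same U
  obtain ⟨σ, hσ⟩ := exists_perm_eigenvalues_eq (x := sortDesc c) hρ.isHermitian (by
    rw [charpoly_mul_comm, ← Matrix.mul_assoc, hUU', Matrix.one_mul])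
  refine ⟨Uᴴ * A * U, hρ, ?_, hdiag, ⟨fun i => Uᴴ *ᵥ φ i, fun i j => ?_, fun i => ?_⟩, ?_, ?_⟩
  · simp only [trace, diag_apply, hdiag]
    exact_mod_cast hd.2
  · rw [star_mulVec, conjTranspose_conjTranspose, ← dotProduct_mulVec, mulVec_mulVec, hUU',
      one_mulVec]
    exact hφ i j
  · rw [star_mulVec, conjTranspose_conjTranspose, ← dotProduct_mulVec, mulVec_mulVec,
      mulVec_mulVec, ← hφp i]
    congr 2
    rw [Matrix.mul_assoc, Matrix.mul_assoc, hUU', Matrix.mul_one, ← Matrix.mul_assoc, hUU',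
      Matrix.one_mul]
  · rw [hσ, sortDesc_comp_perm, hτ, sortDesc_comp_perm, hτ]
  · rw [hσ, shannon_comp_perm, hτ, shannon_comp_perm]
    congr 2
    funext i
    simp [diagVec, hdiag]
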